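/- arXiv:2202.08116 — 4 statements merged into one kernel-verified Lean document; each statement's English description precedes it below -/
import Mathlib

section
/- G = (gcd(σ(q^k)/2, n))² / (σ(q^k)/2); equivalently, G · (σ(q^k)/2) = (gcd(σ(q^k)/2, n))², i.e., gcd(σ(q^k), σ(n²)) · (σ(q^k)/2) = (gcd(σ(q^k)/2, n))². -/
open ArithmeticFunction
open scoped ArithmeticFunction.sigma

theorem geom_parity (q : ℕ) (hq : q % 2 = 1) (m : ℕ) :
    (∑ j ∈ Finset.range m, q ^ j) % 2 = m % 2 := by
  induction m with
  | zero => simp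
  | succ m ih =>
    have h : q ^ m % 2 = 1 := by rw [Nat.pow_mod, hq]; simp
    rw [Finset.sum_range_succ]
    omega

theorem stmt_4 (q k n : ℕ) (hq : q.Prime) (hq4 : q % 4 = 1)
    (hk : 0 < k) (hk4 : k % 4 = 1) (hn : 0 < n) (hqn : Nat.gcd q n = 1)
    (hodd : Odd (q ^ k * n ^ 2))
    (hperf : σ 1 (q ^ k * n ^ 2) = 2 * (q ^ k * n ^ 2)) :
    Nat.gcd (σ 1 (q ^ k)) (σ 1 (n ^ 2)) * (σ 1 (q ^ k) / 2) =
      (Nat.gcd (σ 1 (q ^ k) / 2) n) ^ 2 := by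
  have hcop : Nat.Coprime (q ^ k) (n ^ 2) := Nat.Coprime.pow _ _ hqn
  rw [isMultiplicative_sigma.map_mul_of_coprime hcop] at hperf
  have hsig : σ 1 (q ^ k) = ∑ j ∈ Finset.range (k + 1), q ^ j := by
    rw [sigma_one_apply_prime_pow hq]
  have heven : σ 1 (q ^ k) % 2 = 0 := by
    rw [hsig, geom_parity q (by omega)]; omega
  have hcq : Nat.Coprime q (σ 1 (q ^ k)) := by
    rw [hq.coprime_iff_not_dvd, hsig, Finset.sum_range_succ', pow_zero]
    intro h
    have h1 : q ∣ ∑ j ∈ Finset.range k, q ^ (j + 1) :=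
      Finset.dvd_sum fun j _ => dvd_pow_self q (Nat.succ_ne_zero j)
    exact hq.one_lt.ne' (Nat.dvd_one.mp ((Nat.dvd_add_right h1).mp h))
  obtain ⟨s, hs⟩ : ∃ s, σ 1 (q ^ k) = 2 * s := ⟨σ 1 (q ^ k) / 2, by omega⟩
  rw [hs] at hperf hcq ⊢
  rw [Nat.mul_div_cancel_left s (by norm_num)]
  generalize σ 1 (n ^ 2) = S at *
  have h1 : s * S = q ^ k * n ^ 2 := by
    have : 2 * (s * S) = 2 * (q ^ k * n ^ 2) := by rw [← hperf]; ring
    omega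
  have hcs : Nat.Coprime (q ^ k) s := (Nat.Coprime.coprime_mul_left_right hcq).pow_left k
  have hSodd : Odd S := by
    rw [← h1] at hodd
    exact (Nat.odd_mul.mp hodd).2
  obtain ⟨t, rfl⟩ : q ^ k ∣ S := hcs.dvd_of_dvd_mul_left ⟨n ^ 2, h1⟩
  have hst : s * t = n ^ 2 := by
    have hpos : 0 < q ^ k := pow_pos hq.pos k
    apply Nat.eq_of_mul_eq_mul_left hpos
    rw [← h1]; ring
  rw [Nat.Coprime.gcd_mul_left_cancel s (Nat.coprime_two_left.mpr hSodd),
    Nat.Coprime.gcd_mul_left_cancel_right t hcs, mul_comm, ← Nat.gcd_mul_left, hst, ← sq,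
    Nat.pow_gcd_pow]
end

section
/- If H = I, then n < q^k; moreover, assuming additionally that q < n (a result of Brown), it follows that k > 1. -/
open ArithmeticFunction
open scoped ArithmeticFunction.sigma

theorem aux_lt (q : ℕ) (hq : 2 ≤ q) (j : ℕ) : ∑ i ∈ Finset.range (j+1), q ^ i < 2 * q ^ j := by
  induction j with
  | zero => simp
  | succ j ih =>
    rw [Finset.sum_range_succ, pow_succ]
    nlinarith [Nat.mul_le_mul_left (q ^ j) hq]

theorem aux_even (q : ℕ) (hq : Odd q) (j : ℕ) : 2 ∣ ∑ i ∈ Finset.range (2 * j), q ^ i := by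
  induction j with
  | zero => simp
  | succ j ih =>
    rw [show 2 * (j+1) = 2 * j + 1 + 1 by ring, Finset.sum_range_succ, Finset.sum_range_succ, add_assoc]
    exact dvd_add ih ((hq.pow.add_odd hq.pow).two_dvd)

theorem aux_cop (q k : ℕ) : Nat.Coprime q (∑ i ∈ Finset.range (k+1), q ^ i) := by
  rw [Finset.sum_range_succ']
  simp only [pow_succ, ← Finset.sum_mul, pow_zero, one_mul]
  simp

theorem stmt_6 (q k n : ℕ) (hq : q.Prime) (hq4 : q % 4 = 1)
    (hk : 0 < k) (hk4 : k % 4 = 1) (hn : 0 < n) (hqn : Nat.gcd q n = 1)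
    (hodd : Odd (q ^ k * n ^ 2))
    (hperf : σ 1 (q ^ k * n ^ 2) = 2 * (q ^ k * n ^ 2))
    (hHI : Nat.gcd (n ^ 2) (σ 1 (n ^ 2)) = Nat.gcd n (σ 1 (n ^ 2))) :
    n < q ^ k ∧ (q < n → 1 < k) := by
  have hmain : n < q ^ k := by
    have hc : Nat.Coprime (q ^ k) (n ^ 2) := Nat.Coprime.pow _ _ hqn
    have hS : σ 1 (q ^ k) = ∑ i ∈ Finset.range (k+1), q ^ i := by
      rw [sigma_one_apply_prime_pow hq]
    rw [isMultiplicative_sigma.map_mul_of_coprime hc, hS] at hperf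
    have h1 := aux_lt q hq.two_le k
    have h2 := aux_cop q k
    obtain ⟨s, hs⟩ : 2 ∣ ∑ i ∈ Finset.range (k+1), q ^ i := by
      have := aux_even q (Nat.odd_iff.2 (by omega)) ((k+1)/2)
      rwa [show 2 * ((k+1)/2) = k+1 by omega] at this
    have hd : q ^ k ∣ σ 1 (n ^ 2) := by
      apply (Nat.Coprime.pow_left k h2).dvd_of_dvd_mul_left
      rw [hperf]
      exact ⟨2 * n ^ 2, by ring⟩
    obtain ⟨m, hm⟩ := hd
    rw [hs] at hperf h1
    rw [hm] at hperf hHI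
    have hpos : 0 < q ^ k := pow_pos hq.pos k
    have e : s * m = n ^ 2 := by
      apply Nat.eq_of_mul_eq_mul_left (show 0 < 2 * q ^ k by omega)
      linarith
    have hmn : m ∣ n := by
      have : m ∣ Nat.gcd (n ^ 2) (q ^ k * m) :=
        Nat.dvd_gcd ⟨s, by rw [← e]; ring⟩ ⟨q ^ k, by ring⟩
      rw [hHI] at this
      exact this.trans (Nat.gcd_dvd_left _ _)
    have hle := Nat.le_of_dvd hn hmn
    have : n ≤ s := by
      by_contra h
      push Not at h
      nlinarith
    omega
  refine ⟨hmain, fun h => ?_⟩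
  by_contra h'
  have : k = 1 := by omega
  subst this
  simp at hmain
  omega
end

section
/- With E = n, F = σ(q^k)/2, and J = H/I, the following bounds hold: 9/F ≤ G ≤ F (equivalently, 9 ≤ G·F and G ≤ F), 3E/F ≤ I ≤ E (equivalently, 3n ≤ I·F and I ≤ n), and E/F ≤ J ≤ E/3 (equivalently, n ≤ J·F and 3·J ≤ n). -/
open ArithmeticFunction
open scoped ArithmeticFunction.sigma

theorem aux_core (F H n : ℕ) (hn : 0 < n) (h : F * H = n ^ 2) (ho : Odd n) (hF : 1 < F) :
    9 ≤ Nat.gcd F H * F ∧ Nat.gcd F H ≤ F ∧ 3 * n ≤ Nat.gcd n H * F ∧ Nat.gcd n H ≤ n ∧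
    n ≤ (H / Nat.gcd n H) * F ∧ 3 * (H / Nat.gcd n H) ≤ n := by
  obtain ⟨t, J, hco, hnt, hHJ⟩ := Nat.exists_coprime n H
  have hIpos : 0 < Nat.gcd n H := Nat.gcd_pos_of_pos_left _ hn
  generalize hI : Nat.gcd n H = I at *
  have hdiv : H / I = J := by rw [hHJ]; exact Nat.mul_div_cancel _ hIpos
  rw [hdiv]
  have h1 : F * J = I * t ^ 2 := by
    apply Nat.eq_of_mul_eq_mul_right hIpos
    have : F * (J * I) = (t * I) ^ 2 := by rw [← hHJ, ← hnt]; exact h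
    linarith
  have hJI : J ∣ I := by
    have : J ∣ I * t ^ 2 := ⟨F, by rw [← h1]; ring⟩
    exact (Nat.Coprime.pow_right 2 hco.symm).dvd_of_dvd_mul_right this
  obtain ⟨g, hg⟩ := hJI
  have hJ : 0 < J := Nat.pos_of_ne_zero (by rintro rfl; simp at hg; omega)
  have hFg : F = g * t ^ 2 := by
    apply Nat.eq_of_mul_eq_mul_right hJ
    rw [h1, hg]; ring
  have hHg : H = g * J ^ 2 := by rw [hHJ, hg]; ring
  have hG : Nat.gcd F H = g := by
    rw [hFg, hHg, Nat.gcd_mul_left, Nat.Coprime.pow 2 2 hco, mul_one]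
  rw [hG]
  have hn' : n = g * t * J := by rw [hnt, hg]; ring
  have hgt : Odd (g * t) := by
    rw [hn'] at ho; exact (Nat.odd_mul.1 ho).1
  have hgt3 : 3 ≤ g * t := by
    have hne : g * t ≠ 1 := by
      intro h1
      have := Nat.eq_one_of_mul_eq_one_right h1
      have := Nat.eq_one_of_mul_eq_one_left h1
      subst_vars
      simp_all
    obtain ⟨m, hm⟩ := hgt
    omega
  have ht : 0 < t := Nat.pos_of_ne_zero (by rintro rfl; simp at hgt3)
  refine ⟨?_, ?_, ?_, ?_, ?_, ?_⟩
  · rw [hFg]; nlinarith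
  · rw [hFg]; exact Nat.le_mul_of_pos_right _ (by positivity)
  · calc 3 * n ≤ (g * t) * n := Nat.mul_le_mul_right _ hgt3
      _ = I * F := by rw [hn', hFg, hg]; ring
  · rw [hnt]; exact Nat.le_mul_of_pos_left _ ht
  · calc n = n * 1 := by ring
      _ ≤ n * t := Nat.mul_le_mul_left _ ht
      _ = J * F := by rw [hn', hFg]; ring
  · rw [hn']; exact Nat.mul_le_mul_right _ hgt3

theorem aux_par (q : ℕ) (hq : q % 2 = 1) (m : ℕ) :
    (∑ i ∈ Finset.range m, q ^ i) % 2 = m % 2 := by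
  induction m with
  | zero => simp
  | succ m ih =>
    have : q ^ m % 2 = 1 := by rw [Nat.pow_mod, hq]; simp
    rw [Finset.sum_range_succ]; omega

theorem stmt_18 (q k n : ℕ) (hq : q.Prime) (hq4 : q % 4 = 1)
    (hk : 0 < k) (hk4 : k % 4 = 1) (hn : 0 < n) (hqn : Nat.gcd q n = 1)
    (hodd : Odd (q ^ k * n ^ 2))
    (hperf : σ 1 (q ^ k * n ^ 2) = 2 * (q ^ k * n ^ 2)) :
    9 ≤ Nat.gcd (σ 1 (q ^ k)) (σ 1 (n ^ 2)) * (σ 1 (q ^ k) / 2) ∧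
    Nat.gcd (σ 1 (q ^ k)) (σ 1 (n ^ 2)) ≤ σ 1 (q ^ k) / 2 ∧
    3 * n ≤ Nat.gcd n (σ 1 (n ^ 2)) * (σ 1 (q ^ k) / 2) ∧
    Nat.gcd n (σ 1 (n ^ 2)) ≤ n ∧
    n ≤ (Nat.gcd (n ^ 2) (σ 1 (n ^ 2)) / Nat.gcd n (σ 1 (n ^ 2))) * (σ 1 (q ^ k) / 2) ∧
    3 * (Nat.gcd (n ^ 2) (σ 1 (n ^ 2)) / Nat.gcd n (σ 1 (n ^ 2))) ≤ n := by
  have hcop : Nat.Coprime (q ^ k) (n ^ 2) := Nat.Coprime.pow _ _ hqn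
  have hno : Odd n := by
    have := (Nat.odd_mul.1 hodd).2
    exact (Nat.odd_pow_iff (by norm_num)).1 this
  rw [isMultiplicative_sigma.map_mul_of_coprime hcop] at hperf
  have hs : σ 1 (q ^ k) = ∑ i ∈ Finset.range (k + 1), q ^ i := by
    rw [sigma_one_apply_prime_pow hq]
  have hev := aux_par q (by omega) (k + 1)
  rw [← hs] at hev
  obtain ⟨A, hA, hsA⟩ : ∃ A, 0 < A ∧ σ 1 (q ^ k) = q * A + 1 := by
    refine ⟨∑ i ∈ Finset.range k, q ^ i, ?_, ?_⟩
    · exact Finset.sum_pos (fun i _ => pow_pos hq.pos i) ⟨0, by simpa using hk⟩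
    · rw [hs, Finset.sum_range_succ', Finset.mul_sum]
      simp [pow_succ, mul_comm]
  generalize σ 1 (q ^ k) = s at *
  generalize σ 1 (n ^ 2) = S at *
  obtain ⟨F, rfl⟩ : ∃ F, s = 2 * F := ⟨s / 2, by omega⟩
  have hF2 : 2 * F / 2 = F := by omega
  rw [hF2]
  have hq5 : 5 ≤ q := by have := hq.two_le; omega
  have hF : 1 < F := by nlinarith
  have hFS : F * S = q ^ k * n ^ 2 := by nlinarith
  have hqF : Nat.Coprime q F := by
    rw [hq.coprime_iff_not_dvd]
    intro hd
    have h1 : q ∣ q * A + 1 := by rw [← hsA]; exact Dvd.dvd.mul_left hd 2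
    have := (Nat.dvd_add_right (Dvd.intro A rfl)).1 h1
    have := Nat.le_of_dvd one_pos this
    omega
  have hSo : Odd S := by rw [← hFS] at hodd; exact (Nat.odd_mul.1 hodd).2
  obtain ⟨H, rfl⟩ : q ^ k ∣ S :=
    (Nat.Coprime.pow_left k hqF).dvd_of_dvd_mul_left ⟨_, hFS⟩
  have hFH : F * H = n ^ 2 := by
    apply Nat.eq_of_mul_eq_mul_left (pow_pos hq.pos k)
    rw [← hFS]; ring
  have e1 : Nat.gcd (2 * F) (q ^ k * H) = Nat.gcd F H := by
    rw [Nat.Coprime.gcd_mul_left_cancel _ (Nat.coprime_two_left.2 hSo),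
      Nat.Coprime.gcd_mul_left_cancel_right _ (Nat.Coprime.pow_left k hqF)]
  have e2 : Nat.gcd n (q ^ k * H) = Nat.gcd n H :=
    Nat.Coprime.gcd_mul_left_cancel_right _ (Nat.Coprime.pow_left k hqn)
  have e3 : Nat.gcd (n ^ 2) (q ^ k * H) = H := by
    rw [Nat.Coprime.gcd_mul_left_cancel_right _ hcop, ← hFH]
    simp
  rw [e1, e2, e3]
  exact aux_core F H n hn hFH hno hF
end

section
/- The index i(q) = gcd(n², σ(n²)) satisfies σ(q^k) · gcd(n², σ(n²)) = 2n², q^k · gcd(n², σ(n²)) = σ(n²), and gcd(n², σ(n²)) = q·σ(n²) − 2(q−1)·n². -/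
open ArithmeticFunction
open scoped ArithmeticFunction.sigma

theorem aux_even_s19 (q : ℕ) (h : q % 2 = 1) (m : ℕ) :
    (∑ i ∈ Finset.range m, q ^ i) % 2 = m % 2 := by
  induction m with
  | zero => simp
  | succ m ih =>
    rw [Finset.sum_range_succ, Nat.add_mod, ih, Nat.pow_mod, h]
    simp

theorem aux_geom (q : ℕ) (h : 0 < q) (m : ℕ) :
    (q - 1) * (∑ i ∈ Finset.range m, q ^ i) + 1 = q ^ m := by
  obtain ⟨r, rfl⟩ : ∃ r, q = r + 1 := ⟨q - 1, by omega⟩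
  simp only [Nat.add_sub_cancel]
  induction m with
  | zero => simp
  | succ m ih =>
    rw [Finset.sum_range_succ, pow_succ]
    linarith

theorem stmt_19 (q k n : ℕ) (hq : q.Prime) (hq4 : q % 4 = 1)
    (hk : 0 < k) (hk4 : k % 4 = 1) (hn : 0 < n) (hqn : Nat.gcd q n = 1)
    (hodd : Odd (q ^ k * n ^ 2))
    (hperf : σ 1 (q ^ k * n ^ 2) = 2 * (q ^ k * n ^ 2)) :
    σ 1 (q ^ k) * Nat.gcd (n ^ 2) (σ 1 (n ^ 2)) = 2 * n ^ 2 ∧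
    q ^ k * Nat.gcd (n ^ 2) (σ 1 (n ^ 2)) = σ 1 (n ^ 2) ∧
    Nat.gcd (n ^ 2) (σ 1 (n ^ 2)) = q * σ 1 (n ^ 2) - 2 * (q - 1) * n ^ 2 := by
  have hc : Nat.Coprime (q ^ k) (n ^ 2) := Nat.Coprime.pow _ _ hqn
  rw [isMultiplicative_sigma.map_mul_of_coprime hc] at hperf
  have hs : σ 1 (q ^ k) = ∑ i ∈ Finset.range (k + 1), q ^ i := by
    rw [sigma_one_apply_prime_pow hq]
  have h2 := aux_even_s19 q (by omega) (k + 1)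
  have hg := aux_geom q hq.pos (k + 1)
  rw [← hs] at h2 hg
  generalize σ 1 (q ^ k) = s at *
  generalize σ 1 (n ^ 2) = S at *
  generalize n ^ 2 = M at *
  have hqs : Nat.Coprime q s := by
    rw [hq.coprime_iff_not_dvd]
    intro hd
    have h1 : q ∣ (q - 1) * s + 1 := by rw [hg]; exact dvd_pow_self _ (by omega)
    exact hq.one_lt.ne' (Nat.dvd_one.mp ((Nat.dvd_add_right (hd.mul_left _)).mp h1))
  have hdS : q ^ k ∣ S := by
    have : q ^ k ∣ s * S := by rw [hperf]; exact ⟨2 * M, by ring⟩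
    exact (Nat.Coprime.pow_left k hqs).dvd_of_dvd_mul_left this
  obtain ⟨t, rfl⟩ := hdS
  obtain ⟨u, rfl⟩ : ∃ u, s = 2 * u := ⟨s / 2, by omega⟩
  have hM : M = t * u := by
    have hp : 0 < 2 * q ^ k := by have := pow_pos hq.pos k; omega
    apply Nat.eq_of_mul_eq_mul_left hp
    linarith
  subst hM
  have hgcd : Nat.gcd (t * u) (q ^ k * t) = t := by
    rw [mul_comm (q ^ k) t, Nat.gcd_mul_left]
    have : Nat.Coprime u (q ^ k) :=
      (Nat.Coprime.pow_left k (hqs.coprime_dvd_right ⟨2, by ring⟩)).symm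
    rw [this.gcd_eq_one, mul_one]
  rw [hgcd]
  refine ⟨by ring, rfl, ?_⟩
  have : q * (q ^ k * t) = t + 2 * (q - 1) * (t * u) := by
    have : q * (q ^ k * t) = q ^ (k + 1) * t := by ring
    rw [this, ← hg]; ring
  omega
end
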